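/- For every locally small category 𝒦: if the free colimit completion 𝒫𝒦 is cowellpowered then it is wellpowered; and if moreover 𝒦 is finitely pre-complete, then 𝒫𝒦 is cowellpowered if and only if it is wellpowered. -/

import Mathlib

/- Common definitions for formalizing "How nice are free completions of categories?"
   by Adámek and Rosický. -/

open CategoryTheory CategoryTheory.Limits

universe w w₁ w₂ v₁ u₁

namespace FreeCompletions

/-- A presheaf is *small* if it is a colimit of representables over a small
(`Type w`-indexed) diagram. -/
def IsSmallPresheaf {C : Type u₁} [Category.{v₁} C] (F : Cᵒᵖ ⥤ Type v₁) : Prop :=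
  ∃ (J : Type w) (_ : SmallCategory J) (D : J ⥤ C) (c : Cocone (D ⋙ yoneda)),
    Nonempty (IsColimit c) ∧ Nonempty (c.pt ≅ F)

/-- A presheaf is a (small) coproduct of representables. -/
def IsCoproductOfRepresentables {C : Type u₁} [Category.{v₁} C] (F : Cᵒᵖ ⥤ Type v₁) : Prop :=
  ∃ (I : Type v₁) (A : I → C), Nonempty (F ≅ ∐ fun i => yoneda.obj (A i))

/-- The free coproduct completion `Σ𝒦`, realized as the full subcategory of presheaves
consisting of coproducts of representables. -/
abbrev SigmaCompletion (K : Type u₁) [Category.{v₁} K] :=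
  ObjectProperty.FullSubcategory (IsCoproductOfRepresentables (C := K))

/-- The free colimit completion `𝒫𝒦`, the full subcategory of presheaves
consisting of the small presheaves. -/
abbrev PCompletion (K : Type u₁) [Category.{v₁} K] :=
  ObjectProperty.FullSubcategory (IsSmallPresheaf.{v₁} (C := K))

/-- The object of `Σ𝒦` given by a small family of objects of `𝒦`. -/
noncomputable def famObj {K : Type u₁} [Category.{v₁} K] {I : Type v₁} (B : I → K) :
    SigmaCompletion K :=
  ⟨∐ fun i => yoneda.obj (B i), ⟨I, B, ⟨Iso.refl _⟩⟩⟩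

theorem isSmallPresheaf_coprod {K : Type u₁} [Category.{v₁} K] {I : Type v₁} (B : I → K) :
    IsSmallPresheaf.{v₁} (∐ fun i => yoneda.obj (B i)) := by
  let G := Discrete.functor (fun i => yoneda.obj (B i))
  let e : Discrete.functor B ⋙ yoneda ≅ G := Discrete.natIso (fun i => Iso.refl _)
  exact ⟨Discrete I, inferInstance, Discrete.functor B,
    (Cocone.precompose e.hom).obj (colimit.cocone G),
    ⟨(IsColimit.precomposeHomEquiv e (colimit.cocone G)).symm (colimit.isColimit G)⟩,
    ⟨Iso.refl _⟩⟩

/-- The object of `𝒫𝒦` given by a small coproduct of representables. -/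
noncomputable def pcoprodObj {K : Type u₁} [Category.{v₁} K] {I : Type v₁} (B : I → K) :
    PCompletion K :=
  ⟨∐ fun i => yoneda.obj (B i), isSmallPresheaf_coprod B⟩

/-- A diagram `D` has a *multi-limit*: a set of cones through which every cone
factorizes uniquely (unique member and unique factorization). -/
def HasMultiLimit {J : Type w₁} [Category.{w₂} J] {C : Type u₁} [Category.{v₁} C]
    (D : J ⥤ C) : Prop :=
  ∃ (T : Type w) (c : T → Cone D), ∀ s : Cone D,
    ∃ p : Σ t : T, s ⟶ c t, ∀ q : Σ t : T, s ⟶ c t, q = p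

/-- `𝒦` is finitely multi-complete: every finite diagram has a multi-limit. -/
def FinitelyMultiComplete (C : Type u₁) [Category.{v₁} C] : Prop :=
  ∀ (J : Type) [SmallCategory J] [FinCategory J] (D : J ⥤ C), HasMultiLimit.{v₁} D

/-- A family `A : I → C` has a *multi-product*: a set of cones through which every cone
factorizes uniquely (unique member and unique factorization). -/
def HasMultiProduct {C : Type u₁} [Category.{v₁} C] {I : Type w₁} (A : I → C) : Prop :=
  ∃ (T : Type w) (P : T → C) (π : ∀ t i, P t ⟶ A i),
    ∀ (X : C) (f : ∀ i, X ⟶ A i),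
      ∃ p : Σ t : T, X ⟶ P t, (∀ i, p.2 ≫ π p.1 i = f i) ∧
        ∀ q : Σ t : T, X ⟶ P t, (∀ i, q.2 ≫ π q.1 i = f i) → q = p

/-- `C` has multi-products of all set-indexed families. -/
def HasMultiProducts (C : Type u₁) [Category.{v₁} C] : Prop :=
  ∀ (I : Type v₁) (A : I → C), HasMultiProduct.{v₁} A

/-- A diagram `D` has a *pre-limit*: a set of cones through which every cone
factorizes (not necessarily uniquely). -/
def HasPreLimit {J : Type w₁} [Category.{w₂} J] {C : Type u₁} [Category.{v₁} C]
    (D : J ⥤ C) : Prop :=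
  ∃ (T : Type w) (c : T → Cone D), ∀ s : Cone D, ∃ t : T, Nonempty (s ⟶ c t)

/-- `C` is pre-complete: every small diagram has a pre-limit. -/
def PreComplete (C : Type u₁) [Category.{v₁} C] : Prop :=
  ∀ (J : Type v₁) [SmallCategory J] (D : J ⥤ C), HasPreLimit.{v₁} D

/-- `C` is finitely pre-complete: every finite diagram has a pre-limit. -/
def FinitelyPreComplete (C : Type u₁) [Category.{v₁} C] : Prop :=
  ∀ (J : Type) [SmallCategory J] [FinCategory J] (D : J ⥤ C), HasPreLimit.{v₁} D

/-- A family `A : I → C` has a *pre-product*: a set of cones through which every cone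
factorizes (not necessarily uniquely). -/
def HasPreProduct {C : Type u₁} [Category.{v₁} C] {I : Type w₁} (A : I → C) : Prop :=
  ∃ (T : Type w) (P : T → C) (π : ∀ t i, P t ⟶ A i),
    ∀ (X : C) (f : ∀ i, X ⟶ A i), ∃ (t : T) (h : X ⟶ P t), ∀ i, h ≫ π t i = f i

/-- `C` (with finite products) is cartesian multi-closed: each functor `A × -` is a
left multi-adjoint. -/
def CartesianMultiClosedOf (C : Type u₁) [Category.{v₁} C] [HasFiniteProducts C] : Prop :=
  ∀ A B : C, ∃ (I : Type v₁) (E : I → C) (ev : ∀ i, A ⨯ E i ⟶ B),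
    ∀ (X : C) (c : A ⨯ X ⟶ B),
      ∃ p : Σ i : I, X ⟶ E i, (prod.map (𝟙 A) p.2 ≫ ev p.1 = c) ∧
        ∀ q : Σ i : I, X ⟶ E i, prod.map (𝟙 A) q.2 ≫ ev q.1 = c → q = p

/-- `C` is cartesian multi-closed: it has finite products and each functor `A × -` is a
left multi-adjoint. -/
def CartesianMultiClosed (C : Type u₁) [Category.{v₁} C] : Prop :=
  ∃ h : HasFiniteProducts C, @CartesianMultiClosedOf C _ h

/-- `C` is cartesian closed (as a property: it has finite products and each `A × -`
is a left adjoint). -/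
def CartesianClosedP (C : Type u₁) [Category.{v₁} C] : Prop :=
  ∃ h : CartesianMonoidalCategory C, Nonempty (@MonoidalClosed C _ h.toMonoidalCategory)

/-- `C` is locally cartesian closed: every slice category is cartesian closed. -/
def LocallyCartesianClosedP (C : Type u₁) [Category.{v₁} C] : Prop :=
  ∀ A : C, CartesianClosedP (Over A)

/-- `C` is locally cartesian multi-closed: every slice category is cartesian multi-closed. -/
def LocallyCartesianMultiClosed (C : Type u₁) [Category.{v₁} C] : Prop :=
  ∀ A : C, CartesianMultiClosed (Over A)

/-- `C` (with finite products) is cartesian pre-closed: each functor `C(A × -, B)`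
is a small presheaf. -/
def CartesianPreClosedOf (C : Type u₁) [Category.{v₁} C] [HasFiniteProducts C] : Prop :=
  ∀ A B : C, IsSmallPresheaf.{w} ((prod.functor.obj A).op ⋙ yoneda.obj B)

/-- `C` is cartesian pre-closed: it has finite products and each functor `C(A × -, B)`
is a small presheaf. -/
def CartesianPreClosed (C : Type u₁) [Category.{v₁} C] : Prop :=
  ∃ h : HasFiniteProducts C, @CartesianPreClosedOf.{w} C _ h

/-- `C` (with binary products) has weak simple products. -/
def HasWeakSimpleProductsOf (C : Type u₁) [Category.{v₁} C] [HasBinaryProducts C] : Prop :=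
  ∀ (A X B : C) (b : B ⟶ A ⨯ X),
    ∃ (P : C) (ε : A ⨯ P ⟶ B) (w : P ⟶ X),
      ε ≫ b = prod.map (𝟙 A) w ∧
      ∀ (P' : C) (ε' : A ⨯ P' ⟶ B) (w' : P' ⟶ X), ε' ≫ b = prod.map (𝟙 A) w' →
        ∃ f : P' ⟶ P, ε' = prod.map (𝟙 A) f ≫ ε ∧ w' = f ≫ w

/-- `C` has binary products and weak simple products. -/
def HasWeakSimpleProducts (C : Type u₁) [Category.{v₁} C] : Prop :=
  ∃ h : HasBinaryProducts C, @HasWeakSimpleProductsOf C _ h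

/-- `C` has a subobject classifier: a mono `ε : 1 ⟶ Ω` from the terminal object such that
every monomorphism is a pullback of `ε` along a unique morphism. -/
def HasSubobjectClassifierP (C : Type u₁) [Category.{v₁} C] : Prop :=
  ∃ (T Ω : C) (hT : IsTerminal T) (ε : T ⟶ Ω), Mono ε ∧
    ∀ ⦃U X : C⦄ (m : U ⟶ X), Mono m → ∃! χ : X ⟶ Ω, IsPullback (hT.from U) m ε χ

/-- `C` is an elementary topos: finitely complete, cartesian closed,
with a subobject classifier. -/
def IsElementaryTopos (C : Type u₁) [Category.{v₁} C] : Prop :=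
  HasFiniteLimits C ∧ CartesianClosedP C ∧ HasSubobjectClassifierP C

/-- `C` is a multi-topos: finitely complete, cartesian multi-closed,
with a subobject classifier. -/
def IsMultiTopos (C : Type u₁) [Category.{v₁} C] : Prop :=
  HasFiniteLimits C ∧ CartesianMultiClosed C ∧ HasSubobjectClassifierP C

/-- A coproduct cocone is *universal*: it is stable under pullback. -/
def CofanUniversal {C : Type u₁} [Category.{v₁} C] {I : Type w₁} {X : I → C}
    (c : Cofan X) : Prop :=
  ∀ {W : C} (h : W ⟶ c.pt) (Y : I → C) (p : ∀ i, Y i ⟶ W) (q : ∀ i, Y i ⟶ X i),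
    (∀ i, IsPullback (p i) (q i) h (c.inj i)) → Nonempty (IsColimit (Cofan.mk W p))

/-- A coproduct cocone is *disjoint*: injections are monic with initial pairwise
intersections. -/
def CofanDisjoint {C : Type u₁} [Category.{v₁} C] {I : Type w₁} {X : I → C}
    (c : Cofan X) : Prop :=
  (∀ i, Mono (c.inj i)) ∧
    ∀ i j, i ≠ j → ∀ {Z : C} (u : Z ⟶ X i) (v : Z ⟶ X j),
      IsPullback u v (c.inj i) (c.inj j) → Nonempty (IsInitial Z)

/-- `C` is extensive: finitely complete, with finite coproducts which are
universal and disjoint. -/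
def IsExtensive (C : Type u₁) [Category.{v₁} C] : Prop :=
  HasFiniteLimits C ∧ HasFiniteCoproducts C ∧
    ∀ (I : Type) [Finite I] (X : I → C) (c : Cofan X),
      Nonempty (IsColimit c) → CofanUniversal c ∧ CofanDisjoint c

/-- `C` is infinitary extensive: finitely complete, with small (`Type w`-indexed)
coproducts which are universal and disjoint. -/
def IsInfinitaryExtensive (C : Type u₁) [Category.{v₁} C] : Prop :=
  HasFiniteLimits C ∧ HasCoproducts.{w} C ∧
    ∀ (I : Type w) (X : I → C) (c : Cofan X),
      Nonempty (IsColimit c) → CofanUniversal c ∧ CofanDisjoint c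

/-- A parallel pair `r₁ r₂ : R ⟶ X` is an (internal) equivalence relation. -/
structure IsEquivalenceRelationPair {C : Type u₁} [Category.{v₁} C] {R X : C}
    (r₁ r₂ : R ⟶ X) : Prop where
  jointlyMono : ∀ {Z : C} (a b : Z ⟶ R), a ≫ r₁ = b ≫ r₁ → a ≫ r₂ = b ≫ r₂ → a = b
  refl : ∀ {Z : C} (f : Z ⟶ X), ∃ d : Z ⟶ R, d ≫ r₁ = f ∧ d ≫ r₂ = f
  symm : ∃ s : R ⟶ R, s ≫ r₁ = r₂ ∧ s ≫ r₂ = r₁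
  trans : ∀ {Z : C} (a b : Z ⟶ R), a ≫ r₂ = b ≫ r₁ →
    ∃ t : Z ⟶ R, t ≫ r₁ = a ≫ r₁ ∧ t ≫ r₂ = b ≫ r₂

/-- `C` is a regular category: finitely complete, with (regular epi, mono)
factorizations, and regular epimorphisms are stable under pullback. -/
def IsRegularCat (C : Type u₁) [Category.{v₁} C] : Prop :=
  HasFiniteLimits C ∧
    (∀ {X Y : C} (f : X ⟶ Y), ∃ (Z : C) (e : X ⟶ Z) (m : Z ⟶ Y),
      e ≫ m = f ∧ Nonempty (RegularEpi e) ∧ Mono m) ∧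
    (∀ {P X Y Z : C} (fst : P ⟶ X) (snd : P ⟶ Y) (f : X ⟶ Z) (g : Y ⟶ Z),
      IsPullback fst snd f g → Nonempty (RegularEpi g) → Nonempty (RegularEpi fst))

/-- `C` is an exact (Barr-exact) category: regular with effective equivalence relations. -/
def IsExactCat (C : Type u₁) [Category.{v₁} C] : Prop :=
  IsRegularCat C ∧
    ∀ {R X : C} (r₁ r₂ : R ⟶ X), IsEquivalenceRelationPair r₁ r₂ →
      ∃ (Y : C) (f : X ⟶ Y), IsPullback r₁ r₂ f f

/-- A pretopos is an exact and extensive category. -/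
def IsPretopos (C : Type u₁) [Category.{v₁} C] : Prop :=
  IsExactCat C ∧ IsExtensive C

/-- `C` is additive: preadditive with finite biproducts. -/
def IsAdditive (C : Type u₁) [Category.{v₁} C] : Prop :=
  ∃ p : Preadditive C, letI := p; HasFiniteBiproducts C

/-- `C` is wellpowered: every object has only a set of subobjects. -/
def Wellpowered (C : Type u₁) [Category.{v₁} C] : Prop :=
  ∀ X : C, Small.{w} (Subobject X)

/-- `C` is cowellpowered: every object has only a set of quotient objects. -/
def Cowellpowered (C : Type u₁) [Category.{v₁} C] : Prop :=
  ∀ X : C, Small.{w} (Subobject (Opposite.op X))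

/-- `C` has a clique-like class of objects, indexed by all ordinals. -/
def HasCliqueLikeClass (C : Type u₁) [Category.{v₁} C] : Prop :=
  ∃ (A : Ordinal.{v₁} → C) (R : MorphismProperty C),
    (∀ {X Y Z : C} (v : X ⟶ Y) (u : Y ⟶ Z), R (v ≫ u) → R u) ∧
    (∀ k, ∃ f g : A 0 ⟶ A k, f ≠ g ∧ R f ∧ R g) ∧
    ((∀ i k : Ordinal.{v₁}, 0 < i → i < k → ∀ f : A k ⟶ A i, ¬ R f) ∨
     (∀ k i : Ordinal.{v₁}, 0 < k → k < i → ∀ f : A k ⟶ A i, ¬ R f))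

/-- A presheaf is petty: a quotient of a small coproduct of representables. -/
def IsPetty {C : Type u₁} [Category.{v₁} C] (F : Cᵒᵖ ⥤ Type v₁) : Prop :=
  ∃ (I : Type v₁) (A : I → C) (e : (∐ fun i => yoneda.obj (A i)) ⟶ F), Epi e

/-- A presheaf is lucid: petty, and equalizers of pairs of morphisms from petty
presheaves into it are petty. -/
noncomputable def IsLucid {C : Type u₁} [Category.{v₁} C] (F : Cᵒᵖ ⥤ Type v₁) : Prop :=
  IsPetty F ∧ ∀ (P : Cᵒᵖ ⥤ Type v₁), IsPetty P → ∀ u₁ u₂ : P ⟶ F, IsPetty (equalizer u₁ u₂)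

universe v u

section Helpers

variable {K : Type u} [Category.{v} K]

/-- Restriction of an element of a presheaf along a morphism. -/
def res (F : Kᵒᵖ ⥤ Type v) {k A : K} (h : k ⟶ A) (x : F.obj (Opposite.op A)) :
    F.obj (Opposite.op k) := F.map h.op x

theorem res_id (F : Kᵒᵖ ⥤ Type v) {A : K} (x : F.obj (Opposite.op A)) : res F (𝟙 A) x = x := by
  simp [res]

theorem res_res (F : Kᵒᵖ ⥤ Type v) {k l A : K} (g : l ⟶ k) (h : k ⟶ A)
    (x : F.obj (Opposite.op A)) : res F g (res F h x) = res F (g ≫ h) x := by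
  simp [res]

/-- Component of a morphism of presheaves, as a function. -/
def ap {F G : Kᵒᵖ ⥤ Type v} (φ : F ⟶ G) {k : K} (x : F.obj (Opposite.op k)) :
    G.obj (Opposite.op k) := φ.app (Opposite.op k) x

theorem ap_res {F G : Kᵒᵖ ⥤ Type v} (φ : F ⟶ G) {k A : K} (h : k ⟶ A)
    (x : F.obj (Opposite.op A)) : ap φ (res F h x) = res G h (ap φ x) := by
  simp [ap, res]

theorem ap_comp {F G H : Kᵒᵖ ⥤ Type v} (φ : F ⟶ G) (ψ : G ⟶ H) {k : K}
    (x : F.obj (Opposite.op k)) : ap (φ ≫ ψ) x = ap ψ (ap φ x) := by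
  simp [ap]

theorem hom_ext_ap {F G : Kᵒᵖ ⥤ Type v} {φ ψ : F ⟶ G}
    (h : ∀ (k : K) (x : F.obj (Opposite.op k)), ap φ x = ap ψ x) : φ = ψ := by
  ext k x
  exact h k.unop x

/-- Build a presheaf from functions. -/
def mkPsh (obj : K → Type v) (map : ∀ {k A : K}, (k ⟶ A) → obj A → obj k)
    (hid : ∀ {A : K} (x : obj A), map (𝟙 A) x = x)
    (hcomp : ∀ {k l A : K} (g : l ⟶ k) (h : k ⟶ A) (x : obj A),
      map g (map h x) = map (g ≫ h) x) : Kᵒᵖ ⥤ Type v where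
  obj k := obj k.unop
  map h := ↾(fun x => map h.unop x)
  map_id k := by
    ext x
    exact hid x
  map_comp f g := by
    ext x
    exact (hcomp g.unop f.unop x).symm

/-- Build a morphism of presheaves from functions. -/
def mkHom {F G : Kᵒᵖ ⥤ Type v}
    (φ : ∀ {k : K}, F.obj (Opposite.op k) → G.obj (Opposite.op k))
    (h : ∀ {k A : K} (f : k ⟶ A) (x : F.obj (Opposite.op A)), φ (res F f x) = res G f (φ x)) :
    F ⟶ G where
  app k := ↾(fun x => φ (k := k.unop) x)
  naturality k l f := by
    ext x
    exact h f.unop x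

theorem ap_mkHom {F G : Kᵒᵖ ⥤ Type v}
    (φ : ∀ {k : K}, F.obj (Opposite.op k) → G.obj (Opposite.op k)) (h) {k : K}
    (x : F.obj (Opposite.op k)) : ap (mkHom (F := F) (G := G) φ h) x = φ x := rfl

theorem exists_factor_of_surj {X Y Z : Kᵒᵖ ⥤ Type v} (e : X ⟶ Y) (d : X ⟶ Z)
    (he : ∀ (k : K) (y : Y.obj (Opposite.op k)), ∃ x, ap e x = y)
    (h : ∀ (k : K) (x x' : X.obj (Opposite.op k)), ap e x = ap e x' → ap d x = ap d x') :
    ∃ g : Y ⟶ Z, e ≫ g = d := by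
  choose s hs using he
  refine ⟨mkHom (fun {k} y => ap d (s k y)) ?_, ?_⟩
  · intro k A f y
    rw [← ap_res]
    apply h
    rw [hs, ap_res, hs]
  · apply hom_ext_ap
    intro k x
    rw [ap_comp, ap_mkHom]
    exact h _ _ _ (hs _ _)

theorem exists_factor_of_inj {X Y Z : Kᵒᵖ ⥤ Type v} (m : Y ⟶ X) (n : Z ⟶ X)
    (hm : ∀ (k : K) (y y' : Y.obj (Opposite.op k)), ap m y = ap m y' → y = y')
    (h : ∀ (k : K) (z : Z.obj (Opposite.op k)), ∃ y : Y.obj (Opposite.op k), ap m y = ap n z) :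
    ∃ g : Z ⟶ Y, g ≫ m = n := by
  choose s hs using h
  refine ⟨mkHom (fun {k} y => s k y) ?_, ?_⟩
  · intro k A f y
    apply hm
    rw [hs, ap_res, ap_res, hs]
  · apply hom_ext_ap
    intro k x
    rw [ap_comp, ap_mkHom, hs]

/-- A small presentation of a presheaf by generators and relations. -/
structure Pres (F : Kᵒᵖ ⥤ Type v) where
  I : Type v
  R : Type v
  A : I → K
  B : R → K
  l : R → I
  r : R → I
  f : ∀ ρ, B ρ ⟶ A (l ρ)
  g : ∀ ρ, B ρ ⟶ A (r ρ)
  x : ∀ i, F.obj (Opposite.op (A i))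
  rel : ∀ ρ, res F (f ρ) (x (l ρ)) = res F (g ρ) (x (r ρ))
  gen : ∀ (k : K) (y : F.obj (Opposite.op k)), ∃ (i : I) (h : k ⟶ A i), res F h (x i) = y
  univ : ∀ (G : Kᵒᵖ ⥤ Type v) (y : ∀ i, G.obj (Opposite.op (A i))),
    (∀ ρ, res G (f ρ) (y (l ρ)) = res G (g ρ) (y (r ρ))) →
      ∃ φ : F ⟶ G, ∀ i, ap φ (x i) = y i

theorem Pres.hom_ext {F G : Kᵒᵖ ⥤ Type v} (P : Pres F) {φ ψ : F ⟶ G}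
    (h : ∀ i, ap φ (P.x i) = ap ψ (P.x i)) : φ = ψ := by
  apply hom_ext_ap
  intro k y
  obtain ⟨i, a, rfl⟩ := P.gen k y
  rw [ap_res, ap_res, h]

theorem res_yonedaEquiv {A k : K} {F : Kᵒᵖ ⥤ Type v} (α : yoneda.obj A ⟶ F) (h : k ⟶ A) :
    res F h (yonedaEquiv α) = yonedaEquiv (yoneda.map h ≫ α) :=
  yonedaEquiv_naturality α h

theorem pres_of_isSmall {F : Kᵒᵖ ⥤ Type v} (hF : IsSmallPresheaf.{v} F) : Nonempty (Pres F) := by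
  obtain ⟨J, _, D, c, ⟨hc⟩, ⟨e⟩⟩ := hF
  let ι : ∀ j, yoneda.obj (D.obj j) ⟶ F := fun j => c.ι.app j ≫ e.hom
  have hι : ∀ {j j'} (a : j ⟶ j'), yoneda.map (D.map a) ≫ ι j' = ι j := by
    intro j j' a
    have := c.w a
    simp only [ι]
    rw [← this]
    simp
  refine ⟨⟨J, Σ j j' : J, (j ⟶ j'), D.obj, fun ρ => D.obj ρ.1, fun ρ => ρ.1, fun ρ => ρ.2.1,
    fun ρ => 𝟙 _, fun ρ => D.map ρ.2.2, fun j => yonedaEquiv (ι j), ?_, ?_, ?_⟩⟩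
  · rintro ⟨j, j', a⟩
    rw [res_id, res_yonedaEquiv, hι]
  · intro k y
    obtain ⟨j, h, hh⟩ := Types.jointly_surjective_of_isColimit
      (isColimitOfPreserves ((evaluation _ _).obj (Opposite.op k)) hc)
      (e.inv.app (Opposite.op k) y)
    refine ⟨j, h, ?_⟩
    rw [res_yonedaEquiv, yonedaEquiv_apply]
    have h2 := congrArg (fun z => e.hom.app (Opposite.op k) z) hh
    simp only [Functor.mapCocone_ι_app] at h2
    simp at h2
    simp [ι]
    exact h2
  · intro G y hy
    let s : Cocone (D ⋙ yoneda) :=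
      { pt := G
        ι := { app := fun j => yonedaEquiv.symm (y j)
               naturality := fun j j' a => by
                have := hy ⟨j, j', a⟩
                simp only [res_id] at this
                simp only [Functor.comp_map, Functor.const_obj_map, Category.comp_id, Functor.const_obj_obj]
                rw [yonedaEquiv_symm_naturality_left]
                exact congrArg _ this.symm } }
    refine ⟨e.inv ≫ hc.desc s, fun j => ?_⟩
    have h1 : ι j ≫ e.inv ≫ hc.desc s = yonedaEquiv.symm (y j) := by
      simp only [ι, Category.assoc, Iso.hom_inv_id_assoc]
      exact hc.fac s j
    have h2 := congrArg yonedaEquiv h1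
    rw [yonedaEquiv_comp, Equiv.apply_symm_apply] at h2
    exact h2

theorem Pres.isSmall {F : Kᵒᵖ ⥤ Type v} (P : Pres F) : IsSmallPresheaf.{v} F := by
  let S : MultispanShape.{v, v} := ⟨P.R, P.I, P.l, P.r⟩
  let M : MultispanIndex S K := ⟨P.B, P.A, P.f, P.g⟩
  let c : Cocone (M.multispan ⋙ yoneda) :=
    { pt := F
      ι := { app := fun j => match j with
              | .left ρ => yonedaEquiv.symm (res F (P.f ρ) (P.x (P.l ρ)))
              | .right i => yonedaEquiv.symm (P.x i)
             naturality := by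
              rintro _ _ (_ | ρ | ρ)
              · simp
              · exact yonedaEquiv_symm_naturality_left _ _ _
              · refine (yonedaEquiv_symm_naturality_left _ _ _).trans ?_
                exact congrArg _ (P.rel ρ).symm } }
  have key : ∀ s : Cocone (M.multispan ⋙ yoneda), ∃ φ : F ⟶ s.pt,
      ∀ i : P.I, ap φ (P.x i) = yonedaEquiv (X := P.A i) (s.ι.app (.right i)) := by
    intro s
    apply P.univ
    intro ρ
    refine (res_yonedaEquiv _ _).trans (Eq.trans ?_ (res_yonedaEquiv _ _).symm)
    have h1 := s.w (WalkingMultispan.Hom.fst ρ)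
    have h2 := s.w (WalkingMultispan.Hom.snd ρ)
    exact congrArg yonedaEquiv (h1.trans h2.symm)
  choose d hd using key
  have hfac : ∀ (s : Cocone (M.multispan ⋙ yoneda)) (i : P.I),
      c.ι.app (.right i) ≫ d s = s.ι.app (.right i) := by
    intro s i
    refine (yonedaEquiv_symm_naturality_right _ _ _).trans ?_
    apply (Equiv.symm_apply_eq _).2
    exact hd s i
  refine ⟨WalkingMultispan S, inferInstance, M.multispan, c, ⟨?_⟩, ⟨Iso.refl _⟩⟩
  refine { desc := d, fac := ?_, uniq := ?_ }
  · rintro s (ρ | i)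
    · rw [← s.w (WalkingMultispan.Hom.fst ρ), ← c.w (WalkingMultispan.Hom.fst ρ), Category.assoc]
      congr 1
      exact hfac s _
    · exact hfac s i
  · intro s m hm
    apply P.hom_ext
    intro i
    have h1 : c.ι.app (.right i) ≫ m = c.ι.app (.right i) ≫ d s := (hm _).trans (hfac s i).symm
    have h2 : ap m (P.x i) = ap (d s) (P.x i) := by
      have h3 : yonedaEquiv.symm (P.x i) ≫ m = yonedaEquiv.symm (P.x i) ≫ d s := h1
      rw [yonedaEquiv_symm_naturality_right, yonedaEquiv_symm_naturality_right] at h3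
      exact yonedaEquiv.symm.injective h3
    exact h2


theorem nonempty_pres_yoneda (A : K) : Nonempty (Pres (yoneda.obj A)) := by
  refine ⟨⟨PUnit, PEmpty, fun _ => A, PEmpty.elim, PEmpty.elim, PEmpty.elim, fun ρ => ρ.elim,
    fun ρ => ρ.elim, fun _ => 𝟙 A, fun ρ => ρ.elim, ?_, ?_⟩⟩
  · intro k y
    refine ⟨PUnit.unit, y, ?_⟩
    exact Category.comp_id _
  · intro G y _
    refine ⟨yonedaEquiv.symm (y PUnit.unit), fun _ => ?_⟩
    exact yonedaEquiv.apply_symm_apply (y PUnit.unit)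

theorem Pres.quotient {X Q : Kᵒᵖ ⥤ Type v} (P : Pres X) (q : X ⟶ Q)
    (hq : ∀ (k : K) (y : Q.obj (Opposite.op k)), ∃ x, ap q x = y)
    (T : Type v) (C : T → K) (a b : ∀ t, X.obj (Opposite.op (C t)))
    (hab : ∀ t, ap q (a t) = ap q (b t))
    (hker : ∀ (G : Kᵒᵖ ⥤ Type v) (φ : X ⟶ G), (∀ t, ap φ (a t) = ap φ (b t)) →
      ∀ (k : K) (x y : X.obj (Opposite.op k)), ap q x = ap q y → ap φ x = ap φ y) :
    Nonempty (Pres Q) := by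
  choose ia ha hha using fun t => P.gen _ (a t)
  choose ib hb hhb using fun t => P.gen _ (b t)
  refine ⟨⟨P.I, P.R ⊕ T, P.A, Sum.elim P.B C, Sum.elim P.l ia, Sum.elim P.r ib,
    fun ρ => match ρ with
      | .inl ρ => P.f ρ
      | .inr t => ha t,
    fun ρ => match ρ with
      | .inl ρ => P.g ρ
      | .inr t => hb t, fun i => ap q (P.x i), ?_, ?_, ?_⟩⟩
  · rintro (ρ | t)
    · exact (ap_res _ _ _).symm.trans ((congrArg (ap q) (P.rel ρ)).trans (ap_res _ _ _))
    · refine (ap_res _ _ _).symm.trans (Eq.trans ?_ (ap_res _ _ _))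
      have h1 := hab t
      rw [← hha, ← hhb] at h1
      exact h1
  · intro k y
    obtain ⟨x, rfl⟩ := hq k y
    obtain ⟨i, h, rfl⟩ := P.gen k x
    exact ⟨i, h, (ap_res _ _ _).symm⟩
  · intro G y hy
    obtain ⟨φ, hφ⟩ := P.univ G y (fun ρ => hy (.inl ρ))
    have h1 : ∀ t, ap φ (a t) = ap φ (b t) := by
      intro t
      rw [← hha, ← hhb, ap_res, ap_res, hφ, hφ]
      exact hy (.inr t)
    obtain ⟨g, hg⟩ := exists_factor_of_surj q φ hq (hker G φ h1)
    refine ⟨g, fun i => ?_⟩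
    rw [← ap_comp, hg, hφ]

/-- The coproduct `X + X`. -/
def dbl (X : Kᵒᵖ ⥤ Type v) : Kᵒᵖ ⥤ Type v :=
  mkPsh (fun k => X.obj (Opposite.op k) × Bool) (fun h x => (res X h x.1, x.2))
    (fun x => Prod.ext (res_id _ _) rfl) (fun g h x => Prod.ext (res_res _ _ _ _) rfl)

/-- The injections of `X + X`. -/
def dblInj (X : Kᵒᵖ ⥤ Type v) (b : Bool) : X ⟶ dbl X :=
  mkHom (fun {k} x => ((x, b) : X.obj (Opposite.op k) × Bool)) (fun _ _ => rfl)

theorem Pres.dbl {X : Kᵒᵖ ⥤ Type v} (P : Pres X) : Nonempty (Pres (dbl X)) := by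
  refine ⟨⟨P.I × Bool, P.R × Bool, fun i => P.A i.1, fun ρ => P.B ρ.1, fun ρ => (P.l ρ.1, ρ.2),
    fun ρ => (P.r ρ.1, ρ.2), fun ρ => P.f ρ.1, fun ρ => P.g ρ.1, fun i => (P.x i.1, i.2),
    ?_, ?_, ?_⟩⟩
  · rintro ⟨ρ, b⟩
    exact Prod.ext (P.rel ρ) rfl
  · rintro k ⟨y, b⟩
    obtain ⟨i, h, rfl⟩ := P.gen k y
    exact ⟨(i, b), h, rfl⟩
  · intro G y hy
    have h1 : ∀ b : Bool, ∃ φ : X ⟶ G, ∀ i, ap φ (P.x i) = y (i, b) := fun b =>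
      P.univ G (fun i => y (i, b)) (fun ρ => hy (ρ, b))
    choose φ hφ using h1
    refine ⟨mkHom (F := FreeCompletions.dbl X)
      (fun {k} (x : X.obj (Opposite.op k) × Bool) => ap (φ x.2) x.1) ?_, ?_⟩
    · rintro k A f ⟨x, b⟩
      exact ap_res _ _ _
    · rintro ⟨i, b⟩
      exact hφ b i

/-- Setoid on `X + X` gluing both copies along the image of `m`. -/
def ckSetoid {U X : Kᵒᵖ ⥤ Type v} (m : U ⟶ X) (k : K) :
    Setoid (X.obj (Opposite.op k) × Bool) where
  r a b := a.1 = b.1 ∧ (a.2 = b.2 ∨ ∃ u : U.obj (Opposite.op k), ap m u = a.1)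
  iseqv :=
    { refl := fun _ => ⟨rfl, Or.inl rfl⟩
      symm := by
        rintro ⟨a, b⟩ ⟨a', b'⟩ ⟨h1, h2⟩
        dsimp only at *
        subst h1
        exact ⟨rfl, h2.imp Eq.symm id⟩
      trans := by
        rintro ⟨a, b⟩ ⟨a', b'⟩ ⟨a'', b''⟩ ⟨h1, h2⟩ ⟨h3, h4⟩
        dsimp only at *
        subst h1 h3
        refine ⟨rfl, ?_⟩
        rcases h2 with rfl | h2
        · exact h4
        · exact Or.inr h2 }

/-- The cokernel pair of `m`. -/
def ck {U X : Kᵒᵖ ⥤ Type v} (m : U ⟶ X) : Kᵒᵖ ⥤ Type v :=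
  mkPsh (fun k => Quotient (ckSetoid m k))
    (fun {k A} h => Quotient.map' (fun x => (res X h x.1, x.2)) (by
      rintro ⟨a, b⟩ ⟨a', b'⟩ ⟨h1, h2⟩
      dsimp only at *
      subst h1
      refine ⟨rfl, h2.imp id ?_⟩
      rintro ⟨u, rfl⟩
      exact ⟨res U h u, ap_res _ _ _⟩))
    (by
      intro A x
      induction x using Quotient.inductionOn' with
      | _ x => exact congrArg (Quotient.mk (ckSetoid m A)) (Prod.ext (res_id X x.1) rfl))
    (by
      intro k l A g h x
      induction x using Quotient.inductionOn' with
      | _ x => exact congrArg (Quotient.mk (ckSetoid m l)) (Prod.ext (res_res X g h x.1) rfl))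

/-- The quotient map to the cokernel pair. -/
def ckq {U X : Kᵒᵖ ⥤ Type v} (m : U ⟶ X) : dbl X ⟶ ck m :=
  mkHom (fun {k} (x : X.obj (Opposite.op k) × Bool) => (Quotient.mk (ckSetoid m k) x))
    (fun _ _ => rfl)

theorem ckq_surj {U X : Kᵒᵖ ⥤ Type v} (m : U ⟶ X) (k : K) (y : (ck m).obj (Opposite.op k)) :
    ∃ x, ap (ckq m) x = y :=
  Quotient.exists_rep (s := ckSetoid m k) y

theorem ckq_eq_iff {U X : Kᵒᵖ ⥤ Type v} (m : U ⟶ X) (k : K) (a b : X.obj (Opposite.op k))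
    (s t : Bool) : ap (ckq m) (ap (dblInj X s) a) = ap (ckq m) (ap (dblInj X t) b) ↔
      a = b ∧ (s = t ∨ ∃ u : U.obj (Opposite.op k), ap m u = a) :=
  Quotient.eq (r := ckSetoid m k)

theorem nonempty_pres_ck {U X : Kᵒᵖ ⥤ Type v} (m : U ⟶ X) (PU : Pres U) (PX : Pres X) :
    Nonempty (Pres (ck m)) := by
  obtain ⟨P⟩ := PX.dbl
  refine P.quotient (ckq m) (ckq_surj m) PU.I PU.A
    (fun i => ap (dblInj X true) (ap m (PU.x i)))
    (fun i => ap (dblInj X false) (ap m (PU.x i))) ?_ ?_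
  · intro i
    exact (ckq_eq_iff m _ _ _ _ _).2 ⟨rfl, Or.inr ⟨_, rfl⟩⟩
  · rintro G φ hφ k ⟨a, s⟩ ⟨b, t⟩ hab
    obtain ⟨rfl, h⟩ := (ckq_eq_iff m k a b s t).1 hab
    rcases h with rfl | ⟨u, rfl⟩
    · rfl
    · obtain ⟨i, h, rfl⟩ := PU.gen k u
      have h1 : ∀ s : Bool, ap φ (ap (dblInj X s) (ap m (res U h (PU.x i)))) =
          res G h (ap φ (ap (dblInj X s) (ap m (PU.x i)))) := by
        intro s
        rw [ap_res, ap_res, ap_res]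
      change ap φ (ap (dblInj X s) (ap m (res U h (PU.x i)))) =
        ap φ (ap (dblInj X t) (ap m (res U h (PU.x i))))
      rw [h1, h1]
      cases s <;> cases t <;> simp [hφ]

/-! ### Monomorphisms and epimorphisms in `𝒫𝒦` -/

/-- Object of `𝒫𝒦` from a presentation. -/
def pobj (F : Kᵒᵖ ⥤ Type v) (h : Nonempty (Pres F)) : PCompletion K := ⟨F, h.some.isSmall⟩

theorem pres_obj (X : PCompletion K) : Nonempty (Pres X.obj) := pres_of_isSmall X.property

theorem inj_of_mono {X Y : PCompletion K} (m : X ⟶ Y) [Mono m] (k : K)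
    (a b : X.obj.obj (Opposite.op k)) (h : ap m.hom a = ap m.hom b) : a = b := by
  let Z : PCompletion K := pobj (yoneda.obj k) (nonempty_pres_yoneda k)
  let α : Z ⟶ X := ObjectProperty.homMk (yonedaEquiv.symm a)
  let β : Z ⟶ X := ObjectProperty.homMk (yonedaEquiv.symm b)
  have h1 : α ≫ m = β ≫ m := by
    apply ObjectProperty.hom_ext
    change yonedaEquiv.symm a ≫ m.hom = yonedaEquiv.symm b ≫ m.hom
    rw [yonedaEquiv_symm_naturality_right, yonedaEquiv_symm_naturality_right]
    exact congrArg _ h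
  have h2 : α = β := (cancel_mono m).1 h1
  exact yonedaEquiv.symm.injective (congrArg (fun t : Z ⟶ X => t.hom) h2)

theorem mono_of_inj {X Y : PCompletion K} (m : X ⟶ Y)
    (h : ∀ (k : K) (a b : X.obj.obj (Opposite.op k)), ap m.hom a = ap m.hom b → a = b) :
    Mono m := by
  constructor
  intro Z f g hfg
  apply ObjectProperty.hom_ext
  apply hom_ext_ap
  intro k x
  apply h
  rw [← ap_comp, ← ap_comp]
  exact congrArg (fun t : Z ⟶ Y => ap t.hom x) hfg

theorem epi_of_surj {X Y : PCompletion K} (m : X ⟶ Y)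
    (h : ∀ (k : K) (y : Y.obj.obj (Opposite.op k)), ∃ x, ap m.hom x = y) :
    Epi m := by
  constructor
  intro Z f g hfg
  apply ObjectProperty.hom_ext
  apply hom_ext_ap
  intro k y
  obtain ⟨x, rfl⟩ := h k y
  rw [← ap_comp, ← ap_comp]
  exact congrArg (fun t : X ⟶ Z => ap t.hom x) hfg

theorem surj_of_epi {X Y : PCompletion K} (m : X ⟶ Y) [Epi m] (k : K)
    (y : Y.obj.obj (Opposite.op k)) : ∃ x, ap m.hom x = y := by
  obtain ⟨PX⟩ := pres_obj X
  obtain ⟨PY⟩ := pres_obj Y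
  let Z : PCompletion K := pobj (ck m.hom) (nonempty_pres_ck m.hom PX PY)
  let α : Bool → (Y ⟶ Z) := fun b => ObjectProperty.homMk (dblInj Y.obj b ≫ ckq m.hom)
  have h1 : m ≫ α true = m ≫ α false := by
    apply ObjectProperty.hom_ext
    apply hom_ext_ap
    intro k x
    change ap (m.hom ≫ dblInj Y.obj true ≫ ckq m.hom) x =
      ap (m.hom ≫ dblInj Y.obj false ≫ ckq m.hom) x
    rw [ap_comp, ap_comp, ap_comp, ap_comp]
    exact (ckq_eq_iff m.hom _ _ _ _ _).2 ⟨rfl, Or.inr ⟨_, rfl⟩⟩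
  have h2 : α true = α false := (cancel_epi m).1 h1
  have h3 := congrArg (fun t : Y ⟶ Z => ap t.hom y) h2
  have h4 : ap (dblInj Y.obj true ≫ ckq m.hom) y = ap (dblInj Y.obj false ≫ ckq m.hom) y := h3
  rw [ap_comp, ap_comp, ckq_eq_iff] at h4
  simpa using h4.2

/-! ### First part -/

theorem wellpowered_of_cowellpowered (h : Cowellpowered.{v} (PCompletion K)) :
    Wellpowered.{v} (PCompletion K) := by
  intro X
  obtain ⟨PX⟩ := pres_obj X
  let XX : PCompletion K := pobj (dbl X.obj) PX.dbl
  have := h XX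
  let Q : Subobject X → PCompletion K := fun S =>
    pobj (ck S.arrow.hom) (nonempty_pres_ck S.arrow.hom (pres_obj _).some PX)
  let q : ∀ S, XX ⟶ Q S := fun S => ObjectProperty.homMk (ckq S.arrow.hom)
  have hq : ∀ S, Epi (q S) := fun S => epi_of_surj _ (ckq_surj S.arrow.hom)
  have key : ∀ S S' : Subobject X,
      Subobject.mk (q S).op ≤ Subobject.mk (q S').op → S' ≤ S := by
    intro S S' hle
    have h1 := Subobject.ofMkLEMk_comp hle
    have h2 : q S' ≫ (Subobject.ofMkLEMk _ _ hle).unop = q S := congrArg Quiver.Hom.unop h1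
    let g' : ck S'.arrow.hom ⟶ ck S.arrow.hom := (Subobject.ofMkLEMk _ _ hle).unop.hom
    have hg' : ckq S'.arrow.hom ≫ g' = ckq S.arrow.hom :=
      congrArg (fun t : XX ⟶ Q S => t.hom) h2
    have h3 : ∃ g, g ≫ S.arrow.hom = S'.arrow.hom := by
      apply exists_factor_of_inj
      · exact inj_of_mono S.arrow
      · intro k z
        have h4 := (ckq_eq_iff S'.arrow.hom k (ap S'.arrow.hom z) (ap S'.arrow.hom z)
          true false).2 ⟨rfl, Or.inr ⟨_, rfl⟩⟩
        have h6 := congrArg (ap g') h4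
        have h5 : ∀ w : (dbl X.obj).obj (Opposite.op k),
            ap g' (ap (ckq S'.arrow.hom) w) = ap (ckq S.arrow.hom) w := fun w => by
          rw [← ap_comp, hg']
        rw [h5, h5, ckq_eq_iff] at h6
        simpa using h6.2
    obtain ⟨g, hg⟩ := h3
    exact Subobject.le_of_comm (ObjectProperty.homMk g) (ObjectProperty.hom_ext _ hg)
  refine small_of_injective (f := fun S : Subobject X => Subobject.mk (q S).op) ?_
  intro S S' hS
  exact le_antisymm (key _ _ hS.symm.le) (key _ _ hS.le)

/-! ### Second part -/

/-- A relation between generalized elements of `A` and `B` generated by a small set of spans. -/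
def PettyRel {A B : K} (P : ∀ k : K, (k ⟶ A) → (k ⟶ B) → Prop) : Prop :=
  ∃ (T : Type v) (D : T → K) (p : ∀ t, D t ⟶ A) (q : ∀ t, D t ⟶ B),
    ∀ (k : K) (a : k ⟶ A) (b : k ⟶ B),
      P k a b ↔ ∃ (t : T) (h : k ⟶ D t), h ≫ p t = a ∧ h ≫ q t = b

theorem PettyRel.congr {A B : K} {P Q : ∀ k : K, (k ⟶ A) → (k ⟶ B) → Prop} (hP : PettyRel P)
    (h : ∀ k a b, Q k a b ↔ P k a b) : PettyRel Q := by
  obtain ⟨T, D, p, q, hh⟩ := hP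
  exact ⟨T, D, p, q, fun k a b => (h k a b).trans (hh k a b)⟩

theorem pettyRel_span {A B D : K} (p : D ⟶ A) (q : D ⟶ B) :
    PettyRel (fun k (a : k ⟶ A) (b : k ⟶ B) => ∃ h : k ⟶ D, h ≫ p = a ∧ h ≫ q = b) :=
  ⟨PUnit, fun _ => D, fun _ => p, fun _ => q, fun k a b =>
    ⟨fun ⟨h, hh⟩ => ⟨PUnit.unit, h, hh⟩, fun ⟨_, h, hh⟩ => ⟨h, hh⟩⟩⟩

theorem PettyRel.conv {A B : K} {P : ∀ k : K, (k ⟶ A) → (k ⟶ B) → Prop} (hP : PettyRel P) :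
    PettyRel (fun k (b : k ⟶ B) (a : k ⟶ A) => P k a b) := by
  obtain ⟨T, D, p, q, hh⟩ := hP
  refine ⟨T, D, q, p, fun k b a => (hh k a b).trans ?_⟩
  simp only [and_comm]

theorem PettyRel.iUnion {A B : K} {S : Type v} {P : S → ∀ k : K, (k ⟶ A) → (k ⟶ B) → Prop}
    (hP : ∀ s, PettyRel (P s)) : PettyRel (fun k a b => ∃ s, P s k a b) := by
  choose T D p q hh using hP
  refine ⟨Σ s, T s, fun t => D t.1 t.2, fun t => p t.1 t.2, fun t => q t.1 t.2, fun k a b => ?_⟩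
  simp only [hh, Sigma.exists]

theorem prePullback (hK : FinitelyPreComplete K) {A B C : K} (f : A ⟶ C) (g : B ⟶ C) :
    ∃ (T : Type v) (W : T → K) (p : ∀ t, W t ⟶ A) (q : ∀ t, W t ⟶ B),
      (∀ t, p t ≫ f = q t ≫ g) ∧ ∀ (k : K) (a : k ⟶ A) (b : k ⟶ B), a ≫ f = b ≫ g →
        ∃ (t : T) (h : k ⟶ W t), h ≫ p t = a ∧ h ≫ q t = b := by
  obtain ⟨T, c, hc⟩ := hK WalkingCospan (cospan f g)
  refine ⟨T, fun t => (c t).pt, fun t => PullbackCone.fst (c t), fun t => PullbackCone.snd (c t),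
    fun t => PullbackCone.condition (c t), fun k a b hab => ?_⟩
  obtain ⟨t, ⟨h⟩⟩ := hc (PullbackCone.mk a b hab)
  exact ⟨t, h.hom, h.w WalkingCospan.left, h.w WalkingCospan.right⟩

theorem preProduct (hK : FinitelyPreComplete K) (A B : K) :
    ∃ (T : Type v) (W : T → K) (p : ∀ t, W t ⟶ A) (q : ∀ t, W t ⟶ B),
      ∀ (k : K) (a : k ⟶ A) (b : k ⟶ B),
        ∃ (t : T) (h : k ⟶ W t), h ≫ p t = a ∧ h ≫ q t = b := by
  obtain ⟨T, c, hc⟩ := hK (Discrete WalkingPair) (pair A B)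
  refine ⟨T, fun t => (c t).pt, fun t => BinaryFan.fst (c t), fun t => BinaryFan.snd (c t),
    fun k a b => ?_⟩
  obtain ⟨t, ⟨h⟩⟩ := hc (BinaryFan.mk a b)
  exact ⟨t, h.hom, h.w ⟨WalkingPair.left⟩, h.w ⟨WalkingPair.right⟩⟩

theorem preEqualizer (hK : FinitelyPreComplete K) {A B : K} (f g : A ⟶ B) :
    ∃ (T : Type v) (W : T → K) (p : ∀ t, W t ⟶ A),
      (∀ t, p t ≫ f = p t ≫ g) ∧ ∀ (k : K) (a : k ⟶ A), a ≫ f = a ≫ g →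
        ∃ (t : T) (h : k ⟶ W t), h ≫ p t = a := by
  obtain ⟨T, c, hc⟩ := hK WalkingParallelPair (parallelPair f g)
  refine ⟨T, fun t => (c t).pt, fun t => Fork.ι (c t),
    fun t => Fork.condition (c t), fun k a hab => ?_⟩
  obtain ⟨t, ⟨h⟩⟩ := hc (Fork.ofι a hab)
  exact ⟨t, h.hom, h.w WalkingParallelPair.zero⟩

theorem PettyRel.comp (hK : FinitelyPreComplete K) {A B C : K}
    {P : ∀ k : K, (k ⟶ A) → (k ⟶ C) → Prop} (hP : PettyRel P)
    {Q : ∀ k : K, (k ⟶ C) → (k ⟶ B) → Prop} (hQ : PettyRel Q) :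
    PettyRel (fun k a b => ∃ c, P k a c ∧ Q k c b) := by
  obtain ⟨T, D, p, q, hp⟩ := hP
  obtain ⟨S, E, p', q', hq⟩ := hQ
  choose V W a b hab huniv using fun (t : T) (s : S) => prePullback hK (q t) (p' s)
  refine ⟨Σ t s, V t s, fun x => W x.1 x.2.1 x.2.2, fun x => a _ _ x.2.2 ≫ p x.1,
    fun x => b _ _ x.2.2 ≫ q' x.2.1, fun k u w => ?_⟩
  simp only [hp, hq]
  constructor
  · rintro ⟨c, ⟨t, h, rfl, h2⟩, ⟨s, h', h3, rfl⟩⟩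
    obtain ⟨x, g, rfl, rfl⟩ := huniv t s k h h' (h2.trans h3.symm)
    exact ⟨⟨t, s, x⟩, g, by simp, by simp⟩
  · rintro ⟨⟨t, s, x⟩, g, rfl, rfl⟩
    refine ⟨g ≫ a t s x ≫ q t, ⟨t, g ≫ a t s x, by simp, by simp⟩, ⟨s, g ≫ b t s x, ?_, by simp⟩⟩
    rw [hab]
    simp

theorem PettyRel.inter (hK : FinitelyPreComplete K) {A B : K}
    {P Q : ∀ k : K, (k ⟶ A) → (k ⟶ B) → Prop} (hP : PettyRel P) (hQ : PettyRel Q) :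
    PettyRel (fun k a b => P k a b ∧ Q k a b) := by
  obtain ⟨T, D, p, q, hp⟩ := hP
  obtain ⟨S, E, p', q', hq⟩ := hQ
  choose V W a b hab huniv using fun (t : T) (s : S) => prePullback hK (p t) (p' s)
  choose V' W' e he huniv' using fun (t : T) (s : S) (x : V t s) =>
    preEqualizer hK (a t s x ≫ q t) (b t s x ≫ q' s)
  refine ⟨Σ t s x, V' t s x, fun x => W' x.1 x.2.1 x.2.2.1 x.2.2.2,
    fun x => e _ _ _ x.2.2.2 ≫ a _ _ x.2.2.1 ≫ p x.1,
    fun x => e _ _ _ x.2.2.2 ≫ a _ _ x.2.2.1 ≫ q x.1, fun k u w => ?_⟩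
  simp only [hp, hq]
  constructor
  · rintro ⟨⟨t, h, rfl, rfl⟩, ⟨s, h', h2, h3⟩⟩
    obtain ⟨x, g, rfl, rfl⟩ := huniv t s k h h' h2.symm
    obtain ⟨y, g', rfl⟩ := huniv' t s x k g (by simpa using h3.symm)
    exact ⟨⟨t, s, x, y⟩, g', by simp, by simp⟩
  · rintro ⟨⟨t, s, x, y⟩, g, rfl, rfl⟩
    refine ⟨⟨t, g ≫ e t s x y ≫ a t s x, by simp, by simp⟩,
      ⟨s, g ≫ e t s x y ≫ b t s x, ?_, ?_⟩⟩
    · dsimp only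
      rw [hab]
      simp
    · dsimp only
      rw [he]
      simp

/-- A presheaf with small set of generators whose relations are petty is small. -/
theorem nonempty_pres_of_petty {F : Kᵒᵖ ⥤ Type v} (I : Type v) (A : I → K)
    (x : ∀ i, F.obj (Opposite.op (A i)))
    (gen : ∀ (k : K) (y : F.obj (Opposite.op k)), ∃ (i : I) (h : k ⟶ A i), res F h (x i) = y)
    (hrel : ∀ i j, PettyRel (fun k (p : k ⟶ A i) (q : k ⟶ A j) =>
      res F p (x i) = res F q (x j))) : Nonempty (Pres F) := by
  choose T D p q hpq using hrel
  refine ⟨⟨I, Σ i j, T i j, A, fun ρ => D ρ.1 ρ.2.1 ρ.2.2, fun ρ => ρ.1, fun ρ => ρ.2.1,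
    fun ρ => p _ _ ρ.2.2, fun ρ => q _ _ ρ.2.2, x, ?_, gen, ?_⟩⟩
  · rintro ⟨i, j, t⟩
    exact (hpq i j _ _ _).2 ⟨t, 𝟙 _, by simp, by simp⟩
  · intro G y hy
    have key : ∀ i j k (a : k ⟶ A i) (b : k ⟶ A j), res F a (x i) = res F b (x j) →
        res G a (y i) = res G b (y j) := by
      intro i j k a b hab
      obtain ⟨t, h, rfl, rfl⟩ := (hpq i j k a b).1 hab
      rw [← res_res, ← res_res]
      exact congrArg _ (hy ⟨i, j, t⟩)
    choose s h hs using gen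
    refine ⟨mkHom (fun {k} z => res G (h k z) (y (s k z))) ?_, ?_⟩
    · intro k B f z
      rw [res_res]
      apply key
      rw [hs, ← res_res, hs]
    · intro i
      rw [ap_mkHom]
      conv_rhs => rw [← res_id G (y i)]
      apply key
      rw [hs, res_id]

/-- Formal zigzags of relators. -/
inductive Code {F : Kᵒᵖ ⥤ Type v} (P : Pres F) : P.I → P.I → Type v
  | gen (ρ : P.R) : Code P (P.l ρ) (P.r ρ)
  | refl (i : P.I) : Code P i i
  | symm {i j : P.I} : Code P i j → Code P j i
  | comp {i j m : P.I} : Code P i j → Code P j m → Code P i m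

/-- The relation given by a formal zigzag. -/
def Code.Sem {F : Kᵒᵖ ⥤ Type v} {P : Pres F} :
    ∀ {i j : P.I}, Code P i j → ∀ k : K, (k ⟶ P.A i) → (k ⟶ P.A j) → Prop
  | _, _, .gen ρ => fun k a b => ∃ h : k ⟶ P.B ρ, h ≫ P.f ρ = a ∧ h ≫ P.g ρ = b
  | _, _, .refl i => fun k a b => ∃ h : k ⟶ P.A i, h ≫ 𝟙 _ = a ∧ h ≫ 𝟙 _ = b
  | _, _, .symm c => fun k a b => c.Sem k b a
  | _, _, .comp c d => fun k a b => ∃ w, c.Sem k a w ∧ d.Sem k w b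

theorem Code.pettyRel (hK : FinitelyPreComplete K) {F : Kᵒᵖ ⥤ Type v} {P : Pres F} {i j : P.I}
    (c : Code P i j) : PettyRel c.Sem := by
  induction c with
  | gen ρ => exact pettyRel_span _ _
  | refl i => exact pettyRel_span _ _
  | symm c ih => exact ih.conv
  | comp c d ihc ihd => exact ihc.comp hK ihd

theorem Code.sound {F : Kᵒᵖ ⥤ Type v} {P : Pres F} {i j : P.I}
    (c : Code P i j) : ∀ (k : K) (a : k ⟶ P.A i) (b : k ⟶ P.A j), c.Sem k a b →
      res F a (P.x i) = res F b (P.x j) := by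
  induction c with
  | gen ρ =>
    rintro k a b ⟨h, rfl, rfl⟩
    rw [← res_res, ← res_res, P.rel]
  | refl i =>
    rintro k a b ⟨h, rfl, rfl⟩
    rfl
  | symm c ih => exact fun k a b h => (ih k b a h).symm
  | comp c d ihc ihd =>
    rintro k a b ⟨w, h1, h2⟩
    exact (ihc _ _ _ h1).trans (ihd _ _ _ h2)

theorem Code.stable {F : Kᵒᵖ ⥤ Type v} {P : Pres F} {i j : P.I}
    (c : Code P i j) : ∀ (k l : K) (g : l ⟶ k) (a : k ⟶ P.A i) (b : k ⟶ P.A j), c.Sem k a b →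
      c.Sem l (g ≫ a) (g ≫ b) := by
  induction c with
  | gen ρ =>
    rintro k l g a b ⟨h, rfl, rfl⟩
    exact ⟨g ≫ h, by simp, by simp⟩
  | refl i =>
    rintro k l g a b ⟨h, rfl, rfl⟩
    exact ⟨g ≫ h, by simp, by simp⟩
  | symm c ih => exact fun k l g a b h => ih k l g b a h
  | comp c d ihc ihd =>
    rintro k l g a b ⟨w, h1, h2⟩
    exact ⟨g ≫ w, ihc _ _ _ _ _ h1, ihd _ _ _ _ _ h2⟩

/-- The setoid generated by the relators. -/
def Pres.codeSetoid {F : Kᵒᵖ ⥤ Type v} (P : Pres F) (k : K) : Setoid (Σ i : P.I, k ⟶ P.A i) where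
  r a b := ∃ c : Code P a.1 b.1, c.Sem k a.2 b.2
  iseqv :=
    { refl := fun a => ⟨.refl a.1, a.2, by simp, by simp⟩
      symm := fun ⟨c, h⟩ => ⟨.symm c, h⟩
      trans := fun ⟨c, h⟩ ⟨d, h'⟩ => ⟨.comp c d, _, h, h'⟩ }

/-- The presheaf of zigzag classes. -/
def Pres.codePsh {F : Kᵒᵖ ⥤ Type v} (P : Pres F) : Kᵒᵖ ⥤ Type v :=
  mkPsh (fun k => Quotient (P.codeSetoid k))
    (fun {k A} h => Quotient.map' (fun x => ⟨x.1, h ≫ x.2⟩) (by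
      rintro ⟨i, a⟩ ⟨j, b⟩ ⟨c, hc⟩
      exact ⟨c, c.stable _ _ _ _ _ hc⟩))
    (by
      intro A x
      induction x using Quotient.inductionOn' with
      | _ x =>
        refine congrArg (Quotient.mk (P.codeSetoid A)) ?_
        exact Sigma.ext rfl (heq_of_eq (Category.id_comp _)))
    (by
      intro k l A g h x
      induction x using Quotient.inductionOn' with
      | _ x =>
        refine congrArg (Quotient.mk (P.codeSetoid l)) ?_
        exact Sigma.ext rfl (heq_of_eq (Category.assoc _ _ _).symm))

theorem Pres.complete {F : Kᵒᵖ ⥤ Type v} (P : Pres F) {i j : P.I} {k : K} (a : k ⟶ P.A i)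
    (b : k ⟶ P.A j) (h : res F a (P.x i) = res F b (P.x j)) : ∃ c : Code P i j, c.Sem k a b := by
  let y : ∀ i, P.codePsh.obj (Opposite.op (P.A i)) := fun i =>
    Quotient.mk (P.codeSetoid (P.A i)) ⟨i, 𝟙 _⟩
  have hres : ∀ i (a : k ⟶ P.A i), res P.codePsh a (y i) =
      Quotient.mk (P.codeSetoid k) ⟨i, a ≫ 𝟙 _⟩ := fun _ _ => rfl
  obtain ⟨φ, hφ⟩ := P.univ P.codePsh y (by
    intro ρ
    refine Quotient.sound (s := P.codeSetoid (P.B ρ)) ?_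
    exact ⟨.gen ρ, 𝟙 _, by simp, by simp⟩)
  have h1 := congrArg (ap φ) h
  rw [ap_res, ap_res, hφ, hφ, hres, hres] at h1
  have h2 : ∃ c : Code P i j, c.Sem k (a ≫ 𝟙 _) (b ≫ 𝟙 _) :=
    Quotient.exact (s := P.codeSetoid k) h1
  simpa using h2

theorem Pres.pettyRel (hK : FinitelyPreComplete K) {F : Kᵒᵖ ⥤ Type v} (P : Pres F) {A B : K}
    (a : F.obj (Opposite.op A)) (b : F.obj (Opposite.op B)) :
    PettyRel (fun k (p : k ⟶ A) (q : k ⟶ B) => res F p a = res F q b) := by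
  obtain ⟨i, f, rfl⟩ := P.gen A a
  obtain ⟨j, g, rfl⟩ := P.gen B b
  have h1 : PettyRel (fun k (p : k ⟶ P.A i) (q : k ⟶ P.A j) => ∃ c : Code P i j, c.Sem k p q) :=
    PettyRel.iUnion fun c => c.pettyRel hK
  refine (((pettyRel_span (𝟙 A) f).comp hK h1).comp hK (pettyRel_span g (𝟙 B))).congr ?_
  intro k p q
  rw [res_res, res_res]
  constructor
  · intro h
    exact ⟨q ≫ g, ⟨p ≫ f, ⟨p, by simp, rfl⟩, P.complete _ _ h⟩, ⟨q, rfl, by simp⟩⟩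
  · rintro ⟨_, ⟨_, ⟨p', rfl, rfl⟩, ⟨c, hc⟩⟩, ⟨q', rfl, rfl⟩⟩
    simpa using c.sound _ _ _ hc

/-- The product `X × X`. -/
def sq (X : Kᵒᵖ ⥤ Type v) : Kᵒᵖ ⥤ Type v :=
  mkPsh (fun k => X.obj (Opposite.op k) × X.obj (Opposite.op k))
    (fun h x => (res X h x.1, res X h x.2))
    (fun _ => Prod.ext (res_id _ _) (res_id _ _))
    (fun _ _ _ => Prod.ext (res_res _ _ _ _) (res_res _ _ _ _))

theorem Pres.sq (hK : FinitelyPreComplete K) {X : Kᵒᵖ ⥤ Type v} (P : Pres X) :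
    Nonempty (Pres (sq X)) := by
  choose T W p q huniv using fun i j => preProduct hK (P.A i) (P.A j)
  refine nonempty_pres_of_petty (F := FreeCompletions.sq X) (Σ i j, T i j)
    (fun t => W _ _ t.2.2)
    (fun t => ((res X (p _ _ t.2.2) (P.x t.1), res X (q _ _ t.2.2) (P.x t.2.1)) :
      X.obj (Opposite.op _) × X.obj (Opposite.op _))) ?_ ?_
  · rintro k ⟨a, b⟩
    obtain ⟨i, f, rfl⟩ := P.gen k a
    obtain ⟨j, g, rfl⟩ := P.gen k b
    obtain ⟨t, h, rfl, rfl⟩ := huniv i j k f g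
    exact ⟨⟨i, j, t⟩, h, Prod.ext (res_res _ _ _ _) (res_res _ _ _ _)⟩
  · intro s t
    exact ((P.pettyRel hK (res X (p _ _ s.2.2) (P.x s.1)) (res X (p _ _ t.2.2) (P.x t.1))).inter hK
      (P.pettyRel hK (res X (q _ _ s.2.2) (P.x s.2.1)) (res X (q _ _ t.2.2) (P.x t.2.1)))).congr
      (fun k a b => Prod.ext_iff)

/-- The kernel pair of `e`. -/
def kp {X Y : Kᵒᵖ ⥤ Type v} (e : X ⟶ Y) : Kᵒᵖ ⥤ Type v :=
  mkPsh (fun k => {p : X.obj (Opposite.op k) × X.obj (Opposite.op k) // ap e p.1 = ap e p.2})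
    (fun h x => ⟨(res X h x.1.1, res X h x.1.2), by
      rw [ap_res, ap_res, x.2]⟩)
    (fun _ => Subtype.ext (Prod.ext (res_id _ _) (res_id _ _)))
    (fun _ _ _ => Subtype.ext (Prod.ext (res_res _ _ _ _) (res_res _ _ _ _)))

/-- The inclusion of the kernel pair. -/
def kpi {X Y : Kᵒᵖ ⥤ Type v} (e : X ⟶ Y) : kp e ⟶ sq X :=
  mkHom (fun {k} (x : {p : X.obj (Opposite.op k) × X.obj (Opposite.op k) //
    ap e p.1 = ap e p.2}) => x.1) (fun _ _ => rfl)

theorem kpi_inj {X Y : Kᵒᵖ ⥤ Type v} (e : X ⟶ Y) (k : K) (a b : (kp e).obj (Opposite.op k))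
    (h : ap (kpi e) a = ap (kpi e) b) : a = b :=
  Subtype.ext h

theorem nonempty_pres_kp (hK : FinitelyPreComplete K) {X Y : Kᵒᵖ ⥤ Type v} (e : X ⟶ Y)
    (PX : Pres X) (PY : Pres Y) : Nonempty (Pres (kp e)) := by
  obtain ⟨PXX⟩ := PX.sq hK
  choose T W p q huniv using fun i j => PY.pettyRel hK (ap e (PX.x i)) (ap e (PX.x j))
  have hh : ∀ i j (t : T i j), ap e (res X (p i j t) (PX.x i)) =
      ap e (res X (q i j t) (PX.x j)) := by
    intro i j t
    rw [ap_res, ap_res]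
    exact (huniv i j _ _ _).2 ⟨t, 𝟙 _, by simp, by simp⟩
  let x : ∀ t : (Σ i j, T i j), (kp e).obj (Opposite.op (W _ _ t.2.2)) := fun t =>
    (⟨(res X (p _ _ t.2.2) (PX.x t.1), res X (q _ _ t.2.2) (PX.x t.2.1)), hh _ _ _⟩ :
      {p : X.obj (Opposite.op (W _ _ t.2.2)) × X.obj (Opposite.op (W _ _ t.2.2)) //
        ap e p.1 = ap e p.2})
  refine nonempty_pres_of_petty (F := kp e) (Σ i j, T i j)
    (fun t => W _ _ t.2.2) x ?_ ?_
  · rintro k ⟨⟨a, b⟩, hab⟩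
    obtain ⟨i, f, rfl⟩ := PX.gen k a
    obtain ⟨j, g, rfl⟩ := PX.gen k b
    dsimp only at hab
    rw [ap_res, ap_res] at hab
    obtain ⟨t, h, rfl, rfl⟩ := (huniv i j k f g).1 hab
    exact ⟨⟨i, j, t⟩, h, Subtype.ext (Prod.ext (res_res _ _ _ _) (res_res _ _ _ _))⟩
  · intro s t
    refine (PXX.pettyRel hK (ap (kpi e) (x s)) (ap (kpi e) (x t))).congr (fun k a b => ?_)
    rw [← ap_res, ← ap_res]
    exact ⟨congrArg _, kpi_inj e k _ _⟩

theorem cowellpowered_of_wellpowered (hK : FinitelyPreComplete K)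
    (h : Wellpowered.{v} (PCompletion K)) : Cowellpowered.{v} (PCompletion K) := by
  intro X
  obtain ⟨PX⟩ := pres_obj X
  let XX : PCompletion K := pobj (sq X.obj) (PX.sq hK)
  have := h XX
  let e : ∀ S : Subobject (Opposite.op X), X ⟶ (S : (PCompletion K)ᵒᵖ).unop :=
    fun S => S.arrow.unop
  have he : ∀ S, Epi (e S) := fun S => inferInstanceAs (Epi S.arrow.unop)
  let Q : Subobject (Opposite.op X) → PCompletion K := fun S =>
    pobj (kp (e S).hom) (nonempty_pres_kp hK (e S).hom PX (pres_obj _).some)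
  let q : ∀ S, Q S ⟶ XX := fun S => ObjectProperty.homMk (kpi (e S).hom)
  have hq : ∀ S, Mono (q S) := fun S => mono_of_inj _ (kpi_inj (e S).hom)
  have key : ∀ S S' : Subobject (Opposite.op X),
      Subobject.mk (q S) ≤ Subobject.mk (q S') → S' ≤ S := by
    intro S S' hle
    have h2 := Subobject.ofMkLEMk_comp hle
    let g' : kp (e S).hom ⟶ kp (e S').hom := (Subobject.ofMkLEMk _ _ hle).hom
    have hg' : g' ≫ kpi (e S').hom = kpi (e S).hom :=
      congrArg (fun t : Q S ⟶ XX => t.hom) h2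
    have h3 : ∃ g, (e S).hom ≫ g = (e S').hom := by
      apply exists_factor_of_surj
      · exact surj_of_epi (e S)
      · intro k a b hab
        let z : {p : X.obj.obj (Opposite.op k) × X.obj.obj (Opposite.op k) //
          ap (e S).hom p.1 = ap (e S).hom p.2} := ⟨(a, b), hab⟩
        have h4 : ap (kpi (e S').hom) (ap g' (k := k) z) = ap (kpi (e S).hom) (k := k) z := by
          exact (ap_comp g' (kpi (e S').hom) (k := k) z).symm.trans
            (congrArg (fun t => ap t (k := k) z) hg')
        have h5 : ∀ w : {p : X.obj.obj (Opposite.op k) × X.obj.obj (Opposite.op k) //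
          ap (e S').hom p.1 = ap (e S').hom p.2}, w.1 = (a, b) →
            ap (e S').hom a = ap (e S').hom b := by
          rintro ⟨w, hw⟩ rfl
          exact hw
        exact h5 (ap g' (k := k) z) h4
    obtain ⟨g, hg⟩ := h3
    have h6 : e S ≫ ObjectProperty.homMk g = e S' := ObjectProperty.hom_ext _ hg
    refine Subobject.le_of_comm (Quiver.Hom.op (ObjectProperty.homMk g)) ?_
    exact congrArg Quiver.Hom.op h6
  refine small_of_injective (f := fun S : Subobject (Opposite.op X) => Subobject.mk (q S)) ?_
  intro S S' hS
  exact le_antisymm (key _ _ hS.symm.le) (key _ _ hS.le)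

end Helpers

/-- Proposition 5.1: if `𝒫𝒦` is cowellpowered then it is wellpowered;
and for `𝒦` finitely pre-complete, `𝒫𝒦` is cowellpowered iff it is wellpowered. -/
theorem pCompletion_wellpowered_iff_cowellpowered (K : Type u) [Category.{v} K] :
    (Cowellpowered.{v} (PCompletion K) → Wellpowered.{v} (PCompletion K)) ∧
    (FinitelyPreComplete K →
      (Cowellpowered.{v} (PCompletion K) ↔ Wellpowered.{v} (PCompletion K))) := by
  exact ⟨wellpowered_of_cowellpowered, fun hK =>
    ⟨wellpowered_of_cowellpowered, cowellpowered_of_wellpowered hK⟩⟩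
end FreeCompletions
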